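/- For every integer n ≥ 3 and every vertex u ∈ V, the probability of the event E_{5,u} — that there exists a four-cycle rooted at u whose edge sequence pattern (writing s for a local edge and w for a long-range edge) is (s,w,w,s) — satisfies Pr(E_{5,u}) < ((9/2)·ζ(3) + 63/128) · ln(n/2)^{−2}. -/

import Mathlib

open scoped Classical
open Finset

/-- Vertex set of the `n × n` torus. -/
abbrev Vx (n : ℕ) := Fin n × Fin n

/-- Toroidal distance on the `n × n` torus. -/
def tdist (n : ℕ) (u v : Vx n) : ℕ :=
  min ((u.1 : ℤ) - (v.1 : ℤ)).natAbs (n - ((u.1 : ℤ) - (v.1 : ℤ)).natAbs) +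
  min ((u.2 : ℤ) - (v.2 : ℤ)).natAbs (n - ((u.2 : ℤ) - (v.2 : ℤ)).natAbs)

/-- The normalizing factor at vertex `u`. -/
noncomputable def Zfac (n : ℕ) (u : Vx n) : ℝ :=
  (∑ w ∈ univ.filter (fun w => w ≠ u), ((tdist n u w : ℝ) ^ 2)⁻¹)⁻¹

/-- The probability mass of the outcome `c : V → V` (the vector of long-range choices)
under the UTSW product measure: each vertex `u` independently chooses `c u = v ≠ u`
with probability `Z · d(u,v)⁻²`. -/
noncomputable def mass (n : ℕ) (c : Vx n → Vx n) : ℝ :=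
  ∏ u : Vx n, if c u = u then 0 else Zfac n u * ((tdist n u (c u) : ℝ) ^ 2)⁻¹

/-- Probability of an event under the UTSW product measure. -/
noncomputable def Pr (n : ℕ) (E : Set (Vx n → Vx n)) : ℝ :=
  ∑ c : Vx n → Vx n, if c ∈ E then mass n c else 0

/-- `{x, y}` is an edge of the UTSW random graph `G(c)`. -/
def isEdge (n : ℕ) (c : Vx n → Vx n) (x y : Vx n) : Prop :=
  x ≠ y ∧ (tdist n x y = 1 ∨ c x = y ∨ c y = x)

/-- `{x, y}` is an edge of `G(c)` of the given kind: local (`w = false`, distance one)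
or long-range (`w = true`, distance not one). -/
def edgeKind (n : ℕ) (c : Vx n → Vx n) (x y : Vx n) (w : Bool) : Prop :=
  isEdge n c x y ∧ (tdist n x y = 1 ↔ w = false)

/-- There is a four-cycle rooted at `u` in `G(c)` whose edge sequence has the local/long-range
pattern `(p₁, p₂, p₃, p₄)` (`false` = local edge, `true` = long-range edge). -/
def cyclePat (n : ℕ) (c : Vx n → Vx n) (u : Vx n) (p₁ p₂ p₃ p₄ : Bool) : Prop :=
  ∃ a b e : Vx n, a ≠ b ∧ a ≠ e ∧ b ≠ e ∧ a ≠ u ∧ b ≠ u ∧ e ≠ u ∧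
    edgeKind n c u a p₁ ∧ edgeKind n c a b p₂ ∧ edgeKind n c b e p₃ ∧ edgeKind n c e u p₄

/-- `ζ(3) = ∑_{i ≥ 1} i⁻³`. -/
noncomputable def zeta3 : ℝ := ∑' i : ℕ, ((i + 1 : ℝ) ^ 3)⁻¹

/-- Circular distance on `Fin n`. -/
def cdist (n : ℕ) (x y : Fin n) : ℕ :=
  min ((x : ℤ) - (y : ℤ)).natAbs (n - ((x : ℤ) - (y : ℤ)).natAbs)

lemma tdist_eq_cdist (n : ℕ) (u v : Vx n) :
    tdist n u v = cdist n u.1 v.1 + cdist n u.2 v.2 := rfl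

lemma cdist_comm (n : ℕ) (x y : Fin n) : cdist n x y = cdist n y x := by
  unfold cdist
  rw [← Int.natAbs_neg ((x : ℤ) - y), neg_sub]

lemma tdist_comm (n : ℕ) (u v : Vx n) : tdist n u v = tdist n v u := by
  simp only [tdist_eq_cdist, cdist_comm]

lemma tdist_self (n : ℕ) (u : Vx n) : tdist n u u = 0 := by
  simp [tdist]

lemma cdist_add {n : ℕ} [NeZero n] (x k : Fin n) :
    cdist n x (x + k) = min (k : ℕ) (n - k) := by
  have hx := x.isLt
  have hk := k.isLt
  unfold cdist
  rw [Fin.val_add]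
  rcases lt_or_ge ((x : ℕ) + k) n with h | h
  · rw [Nat.mod_eq_of_lt h]; omega
  · rw [Nat.mod_eq_sub_mod h, Nat.mod_eq_of_lt (by omega)]; omega

/-- A sum over the cycle, split according to the side on which a point lies. -/
lemma sum_cdist {n : ℕ} (hn : 0 < n) (x : Fin n) (f : ℕ → ℝ) :
    ∑ y, f (cdist n x y) =
      f 0 + ∑ i ∈ range (n / 2), f (i + 1) + ∑ i ∈ range ((n - 1) / 2), f (i + 1) := by
  have : NeZero n := ⟨hn.ne'⟩
  rw [← Equiv.sum_comp (Equiv.addLeft x)]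
  simp only [Equiv.coe_addLeft, cdist_add]
  rw [Fin.sum_univ_eq_sum_range (fun k => f (min k (n - k)))]
  conv_lhs => rw [show n = (n / 2 + 1) + (n - 1) / 2 by omega, sum_range_add, sum_range_succ']
  have h0 : f (min 0 (n / 2 + 1 + (n - 1) / 2 - 0)) = f 0 := by simp
  rw [h0, add_comm (f 0)]
  congr 1
  · congr 1
    refine sum_congr rfl fun i hi => ?_
    rw [mem_range] at hi
    congr 1; omega
  · rw [← sum_range_reflect]
    refine sum_congr rfl fun i hi => ?_
    rw [mem_range] at hi
    congr 1; omega

lemma sum_cdist_le {n : ℕ} (hn : 0 < n) (x : Fin n) {f : ℕ → ℝ} (hf : ∀ i, 0 ≤ f i) :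
    ∑ y, f (cdist n x y) ≤ f 0 + 2 * ∑ i ∈ range (n / 2), f (i + 1) := by
  rw [sum_cdist hn]
  have : ∑ i ∈ range ((n - 1) / 2), f (i + 1) ≤ ∑ i ∈ range (n / 2), f (i + 1) :=
    sum_le_sum_of_subset_of_nonneg (range_subset_range.2 (by omega)) fun i _ _ => hf _
  linarith

lemma le_sum_cdist {n : ℕ} (hn : 0 < n) (x : Fin n) {f : ℕ → ℝ} (hf : ∀ i, 0 ≤ f i) :
    f 0 + 2 * ∑ i ∈ range ((n - 1) / 2), f (i + 1) ≤ ∑ y, f (cdist n x y) := by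
  rw [sum_cdist hn]
  have : ∑ i ∈ range ((n - 1) / 2), f (i + 1) ≤ ∑ i ∈ range (n / 2), f (i + 1) :=
    sum_le_sum_of_subset_of_nonneg (range_subset_range.2 (by omega)) fun i _ _ => hf _
  linarith

lemma sum_triangle (N : ℕ) (g : ℕ → ℝ) :
    ∑ i ∈ range N, ∑ j ∈ range (N - i), g (i + j) = ∑ d ∈ range N, (d + 1 : ℝ) * g d := by
  rw [← sum_range_diag_flip N fun i j => g (i + j)]
  refine sum_congr rfl fun d _ => ?_
  rw [sum_congr rfl (g := fun _ => g d)]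
  · simp
  · intro k hk
    rw [mem_range] at hk
    congr 1; omega

lemma sum_shifted_triangle (N : ℕ) (g : ℕ → ℝ) :
    ∑ i ∈ range N, ∑ j ∈ range (N - i), g (i + 1 + (j + 1)) =
      ∑ d ∈ range (N + 1), (d : ℝ) * g (d + 1) := by
  have := sum_triangle N fun d => g (d + 2)
  rw [sum_range_succ']
  simp only [Nat.cast_zero, zero_mul, add_zero, Nat.cast_add, Nat.cast_one]
  rw [← this]
  refine sum_congr rfl fun i _ => sum_congr rfl fun j _ => ?_
  congr 1; ring

/-- There are at most `4 d` vertices at distance `d > 0` from a given vertex. -/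
lemma sum_tdist_le {n : ℕ} (hn : 0 < n) (u : Vx n) {g : ℕ → ℝ} (hg : ∀ i, 0 ≤ g i)
    (h0 : g 0 = 0) :
    ∑ w, g (tdist n u w) ≤
      4 * ∑ d ∈ range (2 * (n / 2) + 1), (d + 1 : ℝ) * g (d + 1) := by
  simp only [Fintype.sum_prod_type, tdist_eq_cdist]
  set m := n / 2
  have h1 : ∀ k, ∑ y, g (k + cdist n u.2 y) ≤ g k + 2 * ∑ j ∈ range m, g (k + (j + 1)) :=
    fun k => sum_cdist_le hn u.2 (f := fun i => g (k + i)) fun i => hg _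
  have h2 : ∑ x, (g (cdist n u.1 x) + 2 * ∑ j ∈ range m, g (cdist n u.1 x + (j + 1))) ≤ _ :=
    sum_cdist_le hn u.1 (f := fun k => g k + 2 * ∑ j ∈ range m, g (k + (j + 1)))
      fun i => add_nonneg (hg _) (mul_nonneg zero_le_two (sum_nonneg fun _ _ => hg _))
  have h3 : ∑ i ∈ range m, ∑ j ∈ range m, g (i + 1 + (j + 1)) ≤
      ∑ i ∈ range (2 * m), ∑ j ∈ range (2 * m - i), g (i + 1 + (j + 1)) := by
    refine (sum_le_sum fun i hi => ?_).trans
      (sum_le_sum_of_subset_of_nonneg (range_subset_range.2 (by omega))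
        fun i _ _ => sum_nonneg fun _ _ => hg _)
    rw [mem_range] at hi
    exact sum_le_sum_of_subset_of_nonneg (range_subset_range.2 (by omega)) fun i _ _ => hg _
  have h4 : ∑ i ∈ range m, g (i + 1) ≤ ∑ i ∈ range (2 * m + 1), g (i + 1) :=
    sum_le_sum_of_subset_of_nonneg (range_subset_range.2 (by omega)) fun i _ _ => hg _
  refine (sum_le_sum fun x _ => h1 _).trans (h2.trans ?_)
  rw [sum_shifted_triangle] at h3
  simp only [h0, zero_add, sum_add_distrib, ← mul_sum, add_mul, one_mul]
  linarith

/-- There are at least `4 d` vertices at distance `d < n / 2` from a given vertex. -/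
lemma le_sum_tdist {n : ℕ} (hn : 0 < n) (u : Vx n) {g : ℕ → ℝ} (hg : ∀ i, 0 ≤ g i) :
    4 * ∑ d ∈ range ((n - 1) / 2), (d + 1 : ℝ) * g (d + 1) ≤ ∑ w, g (tdist n u w) := by
  simp only [Fintype.sum_prod_type, tdist_eq_cdist]
  set m := (n - 1) / 2
  have h1 : ∀ k, g k + 2 * ∑ j ∈ range m, g (k + (j + 1)) ≤ ∑ y, g (k + cdist n u.2 y) :=
    fun k => le_sum_cdist hn u.2 (f := fun i => g (k + i)) fun i => hg _
  have h2 : _ ≤ ∑ x, (g (cdist n u.1 x) + 2 * ∑ j ∈ range m, g (cdist n u.1 x + (j + 1))) :=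
    le_sum_cdist hn u.1 (f := fun k => g k + 2 * ∑ j ∈ range m, g (k + (j + 1)))
      fun i => add_nonneg (hg _) (mul_nonneg zero_le_two (sum_nonneg fun _ _ => hg _))
  have h3 : ∑ i ∈ range m, ∑ j ∈ range (m - i), g (i + 1 + (j + 1)) ≤
      ∑ i ∈ range m, ∑ j ∈ range m, g (i + 1 + (j + 1)) :=
    sum_le_sum fun i _ => sum_le_sum_of_subset_of_nonneg (range_subset_range.2 (by omega))
      fun i _ _ => hg _
  have h4 : 0 ≤ ∑ i ∈ range m, g (0 + (i + 1)) := sum_nonneg fun _ _ => hg _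
  refine le_trans ?_ (h2.trans (sum_le_sum fun x _ => h1 _))
  rw [sum_shifted_triangle, sum_range_succ] at h3
  have h5 := mul_nonneg m.cast_nonneg (hg (m + 1))
  have h6 := hg 0
  simp only [zero_add] at h4
  simp only [zero_add, sum_add_distrib, ← mul_sum, add_mul, one_mul]
  linarith

lemma Zfac_eq (n : ℕ) (u : Vx n) :
    Zfac n u = (∑ w, ((tdist n u w : ℝ) ^ 2)⁻¹)⁻¹ := by
  unfold Zfac
  rw [sum_filter_of_ne]
  rintro w _ h rfl
  simp [tdist_self] at h

lemma log_le_sum_tdist {n : ℕ} (hn : 3 ≤ n) (u : Vx n) :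
    4 * Real.log (n / 2) ≤ ∑ w, ((tdist n u w : ℝ) ^ 2)⁻¹ := by
  refine le_trans ?_ (le_sum_tdist (by omega) u (g := fun d => ((d : ℝ) ^ 2)⁻¹)
    fun _ => by positivity)
  gcongr
  have hm : (n : ℝ) ≤ 2 * ((n - 1) / 2 + 1 : ℕ) := by exact_mod_cast (by omega)
  have hn' : (0 : ℝ) < n := by exact_mod_cast (by omega)
  refine (Real.log_le_log (by positivity) (by linarith)).trans
    ((log_add_one_le_harmonic ((n - 1) / 2)).trans (le_of_eq ?_))
  simp only [harmonic, Rat.cast_sum, Rat.cast_inv]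
  refine sum_congr rfl fun i _ => ?_
  push_cast
  field_simp

lemma Zfac_le {n : ℕ} (hn : 3 ≤ n) (u : Vx n) : Zfac n u ≤ (4 * Real.log (n / 2))⁻¹ := by
  have hn' : (3 : ℝ) ≤ n := by exact_mod_cast hn
  have hl : 0 < Real.log (n / 2) := Real.log_pos (by linarith)
  rw [Zfac_eq]
  exact inv_anti₀ (by positivity) (log_le_sum_tdist hn u)

/-- Probability that `u` chooses `v`. -/
noncomputable def wt (n : ℕ) (u v : Vx n) : ℝ := Zfac n u * ((tdist n u v : ℝ) ^ 2)⁻¹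

lemma Zfac_nonneg (n : ℕ) (u : Vx n) : 0 ≤ Zfac n u := by
  unfold Zfac; positivity

lemma wt_nonneg (n : ℕ) (u v : Vx n) : 0 ≤ wt n u v :=
  mul_nonneg (Zfac_nonneg n u) (by positivity)

lemma sum_wt_le_one (n : ℕ) (u : Vx n) : ∑ v, wt n u v ≤ 1 := by
  simp only [wt, ← mul_sum, Zfac_eq]
  exact inv_mul_le_one

lemma mass_eq (n : ℕ) (c : Vx n → Vx n) : mass n c = ∏ u, wt n u (c u) := by
  refine prod_congr rfl fun u _ => ?_
  split_ifs with h
  · simp [wt, h, tdist_self]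
  · rfl

lemma mass_nonneg (n : ℕ) (c : Vx n → Vx n) : 0 ≤ mass n c := by
  rw [mass_eq]
  exact prod_nonneg fun _ _ => wt_nonneg _ _ _

lemma sum_mass_two_choices_le {n : ℕ} {x y : Vx n} (hxy : x ≠ y) (p q : Vx n) :
    ∑ c, (if c x = p ∧ c y = q then mass n c else 0) ≤ wt n x p * wt n y q := by
  let F : Vx n → Vx n → ℝ := fun u v =>
    if (u = x → v = p) ∧ (u = y → v = q) then wt n u v else 0
  have hF : ∀ u v, 0 ≤ F u v := fun u v => by
    dsimp only [F]; split_ifs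
    exacts [wt_nonneg _ _ _, le_rfl]
  have h1 : ∀ c : Vx n → Vx n,
      (if c x = p ∧ c y = q then mass n c else 0) = ∏ u, F u (c u) := by
    intro c
    split_ifs with h
    · rw [mass_eq]
      refine prod_congr rfl fun u _ => ?_
      dsimp only [F]
      rw [if_pos]
      exact ⟨fun e => e ▸ h.1, fun e => e ▸ h.2⟩
    · symm
      rw [prod_eq_zero_iff]
      by_cases hx : c x = p
      · have hy : c y ≠ q := fun hy => h ⟨hx, hy⟩
        exact ⟨y, mem_univ _, by simp [F, hy]⟩
      · exact ⟨x, mem_univ _, by simp [F, hx]⟩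
  have h2 : ∑ c : Vx n → Vx n, ∏ u, F u (c u) = ∏ u, ∑ v, F u v := by
    rw [prod_univ_sum, Fintype.piFinset_univ]
  have hsx : ∑ v, F x v = wt n x p := by simp [F, hxy]
  have hsy : ∑ v, F y v = wt n y q := by simp [F, hxy.symm]
  simp only [h1]
  rw [h2, ← mul_prod_erase _ _ (mem_univ x),
    ← mul_prod_erase _ _ (mem_erase.2 ⟨hxy.symm, mem_univ y⟩), hsx, hsy, ← mul_assoc]
  refine mul_le_of_le_one_right (mul_nonneg (wt_nonneg _ _ _) (wt_nonneg _ _ _))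
    (prod_le_one (fun u _ => sum_nonneg fun _ _ => hF _ _) fun u _ => ?_)
  refine (sum_le_sum fun v _ => ?_).trans (sum_wt_le_one n u)
  dsimp only [F]; split_ifs
  exacts [le_rfl, wt_nonneg _ _ _]

/-- The vertices at distance one from `u`. -/
noncomputable def nbrs (n : ℕ) (u : Vx n) : Finset (Vx n) := {a | tdist n u a = 1}

lemma card_nbrs_le {n : ℕ} (hn : 0 < n) (u : Vx n) : #(nbrs n u) ≤ 4 := by
  have h := sum_tdist_le hn u (g := fun d => if d = 1 then 1 else 0)
    (fun d => by positivity) (by simp)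
  simp only [sum_boole, Nat.add_eq_right, mul_ite, mul_one, mul_zero] at h
  rw [sum_ite_eq' (range _) 0 fun d : ℕ => (d + 1 : ℝ)] at h
  simp only [mem_range, Nat.succ_pos, if_true, Nat.cast_zero, zero_add, mul_one] at h
  exact_mod_cast h

lemma card_offDiag_nbrs_le {n : ℕ} (hn : 0 < n) (u : Vx n) : #(nbrs n u).offDiag ≤ 12 := by
  rw [offDiag_card]
  have := card_nbrs_le hn u
  interval_cases #(nbrs n u) <;> norm_num

lemma summable_zeta3 : Summable fun i : ℕ => ((i + 1 : ℝ) ^ 3)⁻¹ := by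
  have := (summable_nat_add_iff 1).2 (Real.summable_nat_pow_inv.2 (by norm_num : 1 < 3))
  simpa using this

lemma sum_tdist_pow_four_le {n : ℕ} (hn : 0 < n) (u : Vx n) :
    ∑ b, ((tdist n u b : ℝ) ^ 4)⁻¹ ≤ 4 * zeta3 := by
  refine (sum_tdist_le hn u (g := fun d => ((d : ℝ) ^ 4)⁻¹)
    (fun _ => by positivity) (by simp)).trans ?_
  gcongr
  refine le_trans (le_of_eq (sum_congr rfl fun d _ => ?_))
    (summable_zeta3.sum_le_tsum (range (2 * (n / 2) + 1)) fun i _ => by positivity)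
  push_cast
  field_simp

lemma sum_tdist_mul_le {n : ℕ} (hn : 0 < n) (a e : Vx n) :
    ∑ b, ((tdist n a b : ℝ) ^ 2)⁻¹ * ((tdist n e b : ℝ) ^ 2)⁻¹ ≤ 4 * zeta3 := by
  have h : ∀ b, ((tdist n a b : ℝ) ^ 2)⁻¹ * ((tdist n e b : ℝ) ^ 2)⁻¹ ≤
      (((tdist n a b : ℝ) ^ 4)⁻¹ + ((tdist n e b : ℝ) ^ 4)⁻¹) / 2 := fun b => by
    have := two_mul_le_add_sq ((tdist n a b : ℝ) ^ 2)⁻¹ ((tdist n e b : ℝ) ^ 2)⁻¹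
    simp only [inv_pow, ← pow_mul] at this
    norm_num at this
    linarith
  refine (sum_le_sum fun b _ => h b).trans ?_
  rw [← sum_div, sum_add_distrib]
  linarith [sum_tdist_pow_four_le hn a, sum_tdist_pow_four_le hn e]

/-- The part of the mass of `c` charged to the path `a, b, e`: half of it if `a` and `e` both
choose `b` (this path is counted in both directions), all of it if `a` chooses `b` and `b`
chooses `e`. -/
noncomputable def pathMass (n : ℕ) (c : Vx n → Vx n) (a e b : Vx n) : ℝ :=
  (if c a = b ∧ c e = b then mass n c else 0) / 2 +
    if a ≠ b ∧ c a = b ∧ c b = e then mass n c else 0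

lemma pathMass_nonneg (n : ℕ) (c : Vx n → Vx n) (a e b : Vx n) : 0 ≤ pathMass n c a e b := by
  have := mass_nonneg n c
  unfold pathMass
  positivity

lemma mass_le_sum_pathMass {n : ℕ} {c : Vx n → Vx n} {u : Vx n}
    (h : cyclePat n c u false true true false) :
    mass n c ≤ ∑ p ∈ (nbrs n u).offDiag, ∑ b, pathMass n c p.1 p.2 b := by
  obtain ⟨a, b, e, hab, hae, hbe, -, -, -, hua, ⟨⟨-, hab'⟩, hw⟩, ⟨⟨-, hbe'⟩, hw'⟩, heu⟩ := h
  have hm := mass_nonneg n c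
  have ha : a ∈ nbrs n u := by simpa [nbrs] using hua.2
  have he : e ∈ nbrs n u := by simpa [nbrs, tdist_comm n u e] using heu.2
  have h1 : c a = b ∨ c b = a := hab'.resolve_left (by simpa using hw)
  have h2 : c b = e ∨ c e = b := hbe'.resolve_left (by simpa using hw')
  have hT : ∀ x y, pathMass n c x y b ≤ ∑ b, pathMass n c x y b := fun x y =>
    single_le_sum (fun b _ => pathMass_nonneg n c x y b) (mem_univ b)
  have hsum : ∑ b, pathMass n c a e b + ∑ b, pathMass n c e a b ≤
      ∑ p ∈ (nbrs n u).offDiag, ∑ b, pathMass n c p.1 p.2 b := by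
    rw [← sum_pair (f := fun p : Vx n × Vx n => ∑ b, pathMass n c p.1 p.2 b)
      (show (a, e) ≠ (e, a) by simp [hae])]
    refine sum_le_sum_of_subset_of_nonneg ?_
      fun p _ _ => sum_nonneg fun b _ => pathMass_nonneg _ _ _ _ _
    simp [insert_subset_iff, ha, he, hae, hae.symm]
  refine le_trans ?_ ((add_le_add (hT a e) (hT e a)).trans hsum)
  rcases h1 with h1 | h1 <;> rcases h2 with h2 | h2
  · refine le_add_of_le_of_nonneg (le_add_of_nonneg_of_le (by positivity) ?_)
      (pathMass_nonneg _ _ _ _ _)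
    rw [if_pos ⟨hab, h1, h2⟩]
  · unfold pathMass
    rw [if_pos (⟨h1, h2⟩ : c a = b ∧ c e = b), if_pos (⟨h2, h1⟩ : c e = b ∧ c a = b)]
    have (p : Prop) [Decidable p] : 0 ≤ if p then mass n c else 0 := by positivity
    linarith [this (a ≠ b ∧ c a = b ∧ c b = e), this (e ≠ b ∧ c e = b ∧ c b = a)]
  · exact absurd (h1.symm.trans h2) hae
  · refine le_add_of_nonneg_of_le (pathMass_nonneg _ _ _ _ _)
      (le_add_of_nonneg_of_le (by positivity) ?_)
    rw [if_pos ⟨hbe.symm, h2, h1⟩]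

lemma sum_pathMass_le {n : ℕ} {a e : Vx n} (hae : a ≠ e) (b : Vx n) :
    ∑ c, pathMass n c a e b ≤ wt n a b * wt n e b / 2 + wt n a b * wt n b e := by
  unfold pathMass
  rw [sum_add_distrib, ← sum_div]
  refine add_le_add (div_le_div_of_nonneg_right (sum_mass_two_choices_le hae b b) zero_le_two) ?_
  by_cases hab : a = b
  · simpa [hab] using mul_nonneg (wt_nonneg n b b) (wt_nonneg n b e)
  · simpa only [ne_eq, hab, not_false_eq_true, true_and] using sum_mass_two_choices_le hab b e

lemma sum_sum_pathMass_le {n : ℕ} (hn : 3 ≤ n) {a e : Vx n} (hae : a ≠ e) :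
    ∑ b, ∑ c, pathMass n c a e b ≤ 6 * zeta3 * ((4 * Real.log (n / 2))⁻¹) ^ 2 := by
  set K := (4 * Real.log (n / 2))⁻¹
  have hw : ∀ x y, wt n x y ≤ K * ((tdist n x y : ℝ) ^ 2)⁻¹ := fun x y =>
    mul_le_mul_of_nonneg_right (Zfac_le hn x) (by positivity)
  have hK0 : 0 ≤ K := (Zfac_nonneg n a).trans (Zfac_le hn a)
  have hww : ∀ x y z w, wt n x y * wt n z w ≤
      K ^ 2 * (((tdist n x y : ℝ) ^ 2)⁻¹ * ((tdist n z w : ℝ) ^ 2)⁻¹) := fun x y z w =>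
    (mul_le_mul (hw x y) (hw z w) (wt_nonneg _ _ _) (by positivity)).trans (le_of_eq (by ring))
  have hb : ∀ b, ∑ c, pathMass n c a e b ≤
      3 / 2 * K ^ 2 * (((tdist n a b : ℝ) ^ 2)⁻¹ * ((tdist n e b : ℝ) ^ 2)⁻¹) := fun b => by
    have h1 := hww a b e b
    have h2 := hww a b b e
    rw [tdist_comm n b e] at h2
    linarith [sum_pathMass_le hae b]
  refine (sum_le_sum fun b _ => hb b).trans ?_
  rw [← mul_sum]
  have := mul_le_mul_of_nonneg_left (sum_tdist_mul_le (by omega) a e)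
    (show 0 ≤ 3 / 2 * K ^ 2 by positivity)
  linarith

/-- Probability bound for the event `E5ᵤ`. -/
theorem prob_E5 :
    ∀ n : ℕ, 3 ≤ n → ∀ u : Vx n,
      Pr n {c | cyclePat n c u false true true false} <
        ((9 / 2) * zeta3 + 63 / 128) * (Real.log ((n : ℝ) / 2) ^ 2)⁻¹ := by
  intro n hn u
  have hn' : (3 : ℝ) ≤ n := by exact_mod_cast hn
  have hl : 0 < Real.log (n / 2) := Real.log_pos (by linarith)
  have hz : 0 ≤ zeta3 := tsum_nonneg fun i => by positivity
  have hPr : Pr n {c | cyclePat n c u false true true false} ≤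
      ∑ c, ∑ p ∈ (nbrs n u).offDiag, ∑ b, pathMass n c p.1 p.2 b := by
    refine sum_le_sum fun c _ => ?_
    split_ifs with h
    · exact mass_le_sum_pathMass h
    · exact sum_nonneg fun p _ => sum_nonneg fun b _ => pathMass_nonneg _ _ _ _ _
  have hsum : ∑ c, ∑ p ∈ (nbrs n u).offDiag, ∑ b, pathMass n c p.1 p.2 b ≤
      12 * (6 * zeta3 * ((4 * Real.log (n / 2))⁻¹) ^ 2) := by
    rw [sum_comm]
    refine (sum_le_card_nsmul _ _ (6 * zeta3 * ((4 * Real.log (n / 2))⁻¹) ^ 2)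
      fun p hp => ?_).trans ?_
    · rw [sum_comm]
      exact sum_sum_pathMass_le hn (mem_offDiag.1 hp).2.2
    · rw [nsmul_eq_mul]
      gcongr
      exact_mod_cast card_offDiag_nbrs_le (by omega) u
  refine (hPr.trans hsum).trans_lt ?_
  have : 0 < (Real.log (n / 2) ^ 2)⁻¹ := by positivity
  rw [mul_inv, mul_pow, inv_pow (Real.log _)]
  linarith
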